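/- Let U be a nonempty closed convex subset of a uniformly convex Banach space V, f : V → ℝ continuous and quasi-concave, and K : U → 2^V a continuous set-valued map with nonempty, closed, convex values such that the closure of K(U) is compact. Then there exist ū ∈ U and v̄ ∈ V with ‖v̄ - ū‖ = inf_{u ∈ U} ‖v̄ - u‖ and f(v̄) ≥ f(w) for all w ∈ K(ū). -/

import Mathlib

open Filter Topology Set

def ScDom {A I : Type*} (r : I → A → ℕ) (S : Finset A) : Prop :=
  ∀ y, ∃ i, ∀ x ∈ S, r i y ≤ r i x

lemma scarf_door {A I : Type*} [Fintype A] [Fintype I] [DecidableEq A] [DecidableEq I]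
    (r : I → A → ℕ) (hr : ∀ i, Function.Injective (r i)) (s : I → A)
    (hs2 : ∀ i j y, i ≠ j → y ∉ Set.range s → r i y < r i (s j))
    (τ : Finset A) (hτ : τ.card + 1 = Fintype.card I) (z : A) (hz : z ∈ τ)
    (hzs : z ∉ Set.range s) (hd : ScDom r τ) :
    ∃ F G : Finset A, F ≠ G ∧ ∀ S : Finset A,
      (S.card = Fintype.card I ∧ ScDom r S ∧ τ ⊆ S) ↔ (S = F ∨ S = G) := by
  have hm : ∀ l, ∃ t ∈ τ, ∀ x ∈ τ, r l t ≤ r l x := fun l =>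
    Finset.exists_min_image τ (r l) ⟨z, hz⟩
  choose m hmτ hmin using hm
  have hsurj : ∀ t ∈ τ, ∃ l, m l = t := by
    intro t ht
    obtain ⟨l, hl⟩ := hd t
    exact ⟨l, hr l (le_antisymm (hmin l t ht) (hl _ (hmτ l)))⟩
  obtain ⟨i, j, hij, hmij⟩ : ∃ i j, i ≠ j ∧ m i = m j := by
    obtain ⟨i, _, j, _, h, h'⟩ := Finset.exists_ne_map_eq_of_card_lt_of_maps_to
      (s := (Finset.univ : Finset I)) (t := τ) (f := m)
      (by rw [Finset.card_univ]; omega) (fun a _ => hmτ a)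
    exact ⟨i, j, h, h'⟩
  have hinj : ∀ k, (∀ t ∈ τ, ∃ l, l ≠ k ∧ m l = t) →
      ∀ l l', l ≠ k → l' ≠ k → m l = m l' → l = l' := by
    intro k hk l l' hl hl' e
    have := Finset.injOn_of_surjOn_of_card_le (s := Finset.univ.erase k) (t := τ) m
      (fun a _ => hmτ a) (by
        intro t ht
        obtain ⟨l, hl, e⟩ := hk t ht
        exact ⟨l, by simpa using hl, e⟩)
      (by rw [Finset.card_erase_of_mem (Finset.mem_univ _), Finset.card_univ]; omega)
    exact this (by simpa using hl) (by simpa using hl') e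
  have key : ∀ k, (∀ t ∈ τ, ∃ l, l ≠ k ∧ m l = t) → ∃ x, x ∉ τ ∧ (∀ l, l ≠ k → r l (m l) < r l x) ∧
      (∀ y, (∀ l, l ≠ k → r l (m l) < r l y) → r k y ≤ r k x) ∧ ScDom r (insert x τ) := by
    intro k hk
    obtain ⟨x, hx, hxm⟩ := Finset.exists_max_image
      (Finset.univ.filter (fun y => ∀ l, l ≠ k → r l (m l) < r l y)) (r k)
      ⟨s k, by
        simp only [Finset.mem_filter, Finset.mem_univ, true_and]
        intro l hl
        exact (hmin l z hz).trans_lt (hs2 l k z hl hzs)⟩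
    simp only [Finset.mem_filter, Finset.mem_univ, true_and] at hx hxm
    refine ⟨x, ?_, hx, hxm, ?_⟩
    · intro hxt
      obtain ⟨l, hl, e⟩ := hk x hxt
      have := hx l hl
      rw [e] at this
      exact lt_irrefl _ this
    · have hxk : ∀ t ∈ τ, r k x ≤ r k t := by
        obtain ⟨l, hl⟩ := hd x
        by_cases h : l = k
        · exact h ▸ hl
        · exact absurd (hl _ (hmτ l)) (not_le.2 (hx l h))
      intro y
      by_cases h : ∃ l, l ≠ k ∧ r l y ≤ r l (m l)
      · obtain ⟨l, hl, hy⟩ := h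
        refine ⟨l, fun t ht => ?_⟩
        rcases Finset.mem_insert.1 ht with rfl | ht
        · exact hy.trans (hx l hl).le
        · exact hy.trans (hmin l t ht)
      · push Not at h
        refine ⟨k, fun t ht => ?_⟩
        have := hxm y h
        rcases Finset.mem_insert.1 ht with rfl | ht
        · exact this
        · exact this.trans (hxk t ht)
  have hki : ∀ t ∈ τ, ∃ l, l ≠ i ∧ m l = t := by
    intro t ht
    obtain ⟨l, hl⟩ := hsurj t ht
    by_cases h : l = i
    · exact ⟨j, hij.symm, by rw [← hmij, ← h, hl]⟩
    · exact ⟨l, h, hl⟩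
  have hkj : ∀ t ∈ τ, ∃ l, l ≠ j ∧ m l = t := by
    intro t ht
    obtain ⟨l, hl⟩ := hsurj t ht
    by_cases h : l = j
    · exact ⟨i, hij, by rw [hmij, ← h, hl]⟩
    · exact ⟨l, h, hl⟩
  obtain ⟨x, hxt, hx, hxm, hxd⟩ := key i hki
  obtain ⟨w, hwt, hw, hwm, hwd⟩ := key j hkj
  refine ⟨insert x τ, insert w τ, ?_, ?_⟩
  · intro e
    have hxw : x = w := by
      have : x ∈ insert w τ := e ▸ Finset.mem_insert_self x τ
      rcases Finset.mem_insert.1 this with h | h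
      · exact h
      · exact absurd h hxt
    subst hxw
    obtain ⟨l, hl⟩ := hd x
    have h1 := hl _ (hmτ l)
    by_cases h : l = i
    · exact absurd h1 (not_le.2 (hw l (h ▸ hij)))
    · exact absurd h1 (not_le.2 (hx l h))
  · intro S
    constructor
    · rintro ⟨hc, hSd, hsub⟩
      obtain ⟨v, hv⟩ : ∃ v, S \ τ = {v} := Finset.card_eq_one.1 (by
        rw [Finset.card_sdiff_of_subset hsub]; omega)
      have hvS : v ∈ S ∧ v ∉ τ := by
        rw [← Finset.mem_sdiff, hv]; simp
      have hS : S = insert v τ := by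
        rw [← Finset.sdiff_union_of_subset hsub, hv]; rfl
      obtain ⟨k, hk⟩ := hSd v
      have hk1 : ∀ t ∈ τ, ∃ l, l ≠ k ∧ m l = t ∧ ∀ x ∈ S, r l t ≤ r l x := by
        intro t ht
        obtain ⟨l, hl⟩ := hSd t
        refine ⟨l, ?_, hr l (le_antisymm (hmin l t ht) (hl _ (hsub (hmτ l)))), hl⟩
        rintro rfl
        have := hr l (le_antisymm (hl v hvS.1) (hk t (hsub ht)))
        exact hvS.2 (this ▸ ht)
      have hik := hinj k (fun t ht => by
        obtain ⟨l, h1, h2, _⟩ := hk1 t ht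
        exact ⟨l, h1, h2⟩)
      have hvX : ∀ l, l ≠ k → r l (m l) < r l v := by
        intro l hl
        obtain ⟨l', h1, h2, h3⟩ := hk1 (m l) (hmτ l)
        have := hik l' l h1 hl h2
        subst this
        refine lt_of_le_of_ne (h3 v hvS.1) fun e => ?_
        exact hvS.2 (hr _ e ▸ hmτ l')
      have fin : ∀ x, (∀ l, l ≠ k → r l (m l) < r l x) →
          (∀ y, (∀ l, l ≠ k → r l (m l) < r l y) → r k y ≤ r k x) → v = x := by
        intro x hx hxm
        obtain ⟨l, hl⟩ := hSd x
        have hlk : l = k := by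
          by_contra h
          exact absurd (hl _ (hsub (hmτ l))) (not_le.2 (hx l h))
        subst hlk
        exact hr l (le_antisymm (hxm v hvX) (hl v hvS.1))
      by_cases h1 : k = i
      · subst h1
        left; rw [hS, fin x hx hxm]
      by_cases h2 : k = j
      · subst h2
        right; rw [hS, fin w hw hwm]
      exact absurd (hik i j (Ne.symm h1) (Ne.symm h2) hmij) hij
    · rintro (rfl | rfl)
      · exact ⟨by rw [Finset.card_insert_of_notMem hxt, hτ], hxd, Finset.subset_insert _ _⟩
      · exact ⟨by rw [Finset.card_insert_of_notMem hwt, hτ], hwd, Finset.subset_insert _ _⟩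

lemma scarf_bdry {A I : Type*} [Fintype A] [Fintype I] [DecidableEq A] [DecidableEq I]
    (r : I → A → ℕ) (hr : ∀ i, Function.Injective (r i)) (s : I → A)
    (hs1 : ∀ i y, y ≠ s i → r i (s i) < r i y)
    (hs2 : ∀ i j y, i ≠ j → y ∉ Set.range s → r i y < r i (s j))
    (hsi : Function.Injective s)
    (z : A) (hzs : z ∉ Set.range s) (i0 : I) :
    ∃ F : Finset A, ∀ S : Finset A,
      (S.card = Fintype.card I ∧ ScDom r S ∧ (Finset.univ.erase i0).image s ⊆ S) ↔ S = F := by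
  classical
  obtain ⟨x, hx, hxm⟩ := Finset.exists_max_image
      (Finset.univ.filter (fun y => y ∉ Set.range s)) (r i0) ⟨z, by simpa using hzs⟩
  simp only [Finset.mem_filter, Finset.mem_univ, true_and] at hx hxm
  set τ := (Finset.univ.erase i0).image s with hτd
  have hτ : τ.card + 1 = Fintype.card I := by
    rw [Finset.card_image_of_injective _ hsi, Finset.card_erase_of_mem (Finset.mem_univ _),
      Finset.card_univ]
    have : 0 < Fintype.card I := Fintype.card_pos_iff.2 ⟨i0⟩
    omega
  have hmem : ∀ t, t ∈ τ ↔ ∃ p, p ≠ i0 ∧ s p = t := by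
    intro t; simp [hτd]
  refine ⟨insert x τ, fun S => ⟨?_, ?_⟩⟩
  · rintro ⟨hc, hSd, hsub⟩
    obtain ⟨v, hv⟩ : ∃ v, S \ τ = {v} := Finset.card_eq_one.1 (by
      rw [Finset.card_sdiff_of_subset hsub]; omega)
    have hvS : v ∈ S ∧ v ∉ τ := by
      rw [← Finset.mem_sdiff, hv]; simp
    have hS : S = insert v τ := by
      rw [← Finset.sdiff_union_of_subset hsub, hv]; rfl
    have hle : ∀ y, y ∉ Set.range s → r i0 y ≤ r i0 v := by
      intro y hy
      obtain ⟨l, hl⟩ := hSd y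
      by_cases h : l = i0
      · exact h ▸ hl v hvS.1
      · have := hl (s l) (hsub ((hmem _).2 ⟨l, h, rfl⟩))
        exact absurd this (not_le.2 (hs1 l y fun e => hy ⟨l, e.symm⟩))
    have hvs : v ∉ Set.range s := by
      rintro ⟨p, rfl⟩
      by_cases h : p = i0
      · subst h
        exact absurd (hle z hzs) (not_le.2 (hs1 p z fun e => hzs ⟨p, e.symm⟩))
      · exact hvS.2 ((hmem _).2 ⟨p, h, rfl⟩)
    rw [hS, hr i0 (le_antisymm (hxm v hvs) (hle x hx))]
  · rintro rfl
    have hxt : x ∉ τ := by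
      intro h
      obtain ⟨p, _, e⟩ := (hmem _).1 h
      exact hx ⟨p, e⟩
    refine ⟨by rw [Finset.card_insert_of_notMem hxt, hτ], ?_, Finset.subset_insert _ _⟩
    intro y
    by_cases hy : ∃ p, s p = y
    · obtain ⟨p, rfl⟩ := hy
      refine ⟨p, fun t _ => ?_⟩
      by_cases h : t = s p
      · rw [h]
      · exact (hs1 p t h).le
    · refine ⟨i0, fun t ht => ?_⟩
      have h1 := hxm y hy
      rcases Finset.mem_insert.1 ht with rfl | ht
      · exact h1
      · obtain ⟨p, hp, rfl⟩ := (hmem _).1 ht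
        exact h1.trans (hs2 i0 p x hp.symm hx).le

theorem scarf {A I : Type*} [Fintype A] [Fintype I] [DecidableEq A] [DecidableEq I]
    [Nonempty I]
    (r : I → A → ℕ) (hr : ∀ i, Function.Injective (r i)) (s : I → A)
    (hs1 : ∀ i y, y ≠ s i → r i (s i) < r i y)
    (hs2 : ∀ i j y, i ≠ j → y ∉ Set.range s → r i y < r i (s j))
    (z : A) (hzs : z ∉ Set.range s)
    (c : A → I) (hc : ∀ i, c (s i) = i) :
    ∃ S : Finset A, ScDom r S ∧ ∀ i, ∃ x ∈ S, c x = i := by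
  classical
  by_contra hcon
  push Not at hcon
  have hsi : Function.Injective s := fun a b h => by rw [← hc a, h, hc b]
  obtain ⟨i0⟩ := ‹Nonempty I›
  have hcard : (Finset.univ.erase i0).card + 1 = Fintype.card I := by
    rw [Finset.card_erase_of_mem (Finset.mem_univ _), Finset.card_univ]
    have : 0 < Fintype.card I := Fintype.card_pos_iff.2 ⟨i0⟩
    omega
  let R : Finset (Finset A) := Finset.univ.filter
    (fun S => S.card = Fintype.card I ∧ ScDom r S)
  let D : Finset (Finset A) := Finset.univ.filter
    (fun τ => τ.card + 1 = Fintype.card I ∧ τ.image c = Finset.univ.erase i0)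
  have hcount := Finset.sum_card_bipartiteAbove_eq_sum_card_bipartiteBelow
    (s := R) (t := D) (fun S τ => τ ⊆ S)
  have hleft : Even (∑ S ∈ R, (D.bipartiteAbove (fun S τ => τ ⊆ S) S).card) := by
    refine Finset.even_sum _ fun S hS => ?_
    simp only [R, Finset.mem_filter, Finset.mem_univ, true_and] at hS
    rcases (D.bipartiteAbove (fun S τ => τ ⊆ S) S).eq_empty_or_nonempty with h | ⟨τ, h⟩
    · rw [h]; simp
    have hmem : ∀ τ, τ ∈ D.bipartiteAbove (fun S τ => τ ⊆ S) S ↔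
        (τ.card + 1 = Fintype.card I ∧ τ.image c = Finset.univ.erase i0) ∧ τ ⊆ S := by
      intro τ; simp [Finset.bipartiteAbove, D]
    obtain ⟨⟨h1, h2⟩, h3⟩ := (hmem τ).1 h
    obtain ⟨v, hv⟩ : ∃ v, S \ τ = {v} := Finset.card_eq_one.1 (by
      rw [Finset.card_sdiff_of_subset h3]; omega)
    have hvS : v ∈ S ∧ v ∉ τ := by
      rw [← Finset.mem_sdiff, hv]; simp
    have hSi : S = insert v τ := by
      rw [← Finset.sdiff_union_of_subset h3, hv]; rfl
    have hinj : Set.InjOn c τ := Finset.card_image_iff.1 (by rw [h2]; omega)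
    have hcv : c v ≠ i0 := by
      intro hcv
      obtain ⟨i, hi⟩ := hcon S hS.2
      by_cases h : i = i0
      · exact hi v hvS.1 (hcv.trans h.symm)
      · have : i ∈ τ.image c := by rw [h2]; simpa using h
        obtain ⟨x, hx, e⟩ := Finset.mem_image.1 this
        exact hi x (h3 hx) e
    have : c v ∈ τ.image c := by rw [h2]; simpa using hcv
    obtain ⟨w, hw, hwv⟩ := Finset.mem_image.1 this
    have hvw : v ≠ w := fun e => hvS.2 (e ▸ hw)
    have : D.bipartiteAbove (fun S τ => τ ⊆ S) S = {S.erase v, S.erase w} := by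
      ext ρ
      rw [hmem]
      simp only [Finset.mem_insert, Finset.mem_singleton]
      constructor
      · rintro ⟨⟨g1, g2⟩, g3⟩
        obtain ⟨u, hu⟩ : ∃ u, S \ ρ = {u} := Finset.card_eq_one.1 (by
          rw [Finset.card_sdiff_of_subset g3]; omega)
        have huS : u ∈ S ∧ u ∉ ρ := by
          rw [← Finset.mem_sdiff, hu]; simp
        have hρ : ρ = S.erase u := by
          rw [← Finset.sdiff_singleton_eq_erase, ← hu, Finset.sdiff_sdiff_eq_self g3]
        by_cases e1 : u = v
        · left; rw [hρ, e1]
        by_cases e2 : u = w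
        · right; rw [hρ, e2]
        exfalso
        have hinj' : Set.InjOn c ρ := Finset.card_image_iff.1 (by rw [g2]; omega)
        have := @hinj' v (by rw [hρ]; simp [hvS.1, Ne.symm e1])
          w (by rw [hρ]; simp [h3 hw, Ne.symm e2]) hwv.symm
        exact hvw this
      · have hv1 : S.erase v = τ := by rw [hSi, Finset.erase_insert hvS.2]
        rintro (rfl | rfl)
        · rw [hv1]; exact ⟨⟨h1, h2⟩, h3⟩
        · refine ⟨⟨?_, ?_⟩, Finset.erase_subset _ _⟩
          · rw [Finset.card_erase_of_mem (h3 hw), hS.1]; omega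
          · rw [← h2]
            ext i
            simp only [Finset.mem_image, Finset.mem_erase]
            constructor
            · rintro ⟨a, ⟨ha, haS⟩, rfl⟩
              rw [hSi] at haS
              rcases Finset.mem_insert.1 haS with rfl | h
              · exact ⟨w, hw, hwv⟩
              · exact ⟨a, h, rfl⟩
            · rintro ⟨a, ha, rfl⟩
              by_cases e : a = w
              · exact ⟨v, ⟨hvw, hvS.1⟩, by rw [e, hwv]⟩
              · exact ⟨a, ⟨e, h3 ha⟩, rfl⟩
    rw [this, Finset.card_pair]
    · exact even_two
    · intro e
      have : v ∈ S.erase w := by simp [hvw, hvS.1]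
      rw [← e] at this
      simp at this
  have hmemB : ∀ τ S, S ∈ R.bipartiteBelow (fun S τ => τ ⊆ S) τ ↔
        (S.card = Fintype.card I ∧ ScDom r S ∧ τ ⊆ S) := by
      intro τ S; simp [Finset.bipartiteBelow, R, and_assoc]
  have hτ0 : (Finset.univ.erase i0).image s ∈ D := by
    simp only [D, Finset.mem_filter, Finset.mem_univ, true_and]
    refine ⟨by rw [Finset.card_image_of_injective _ hsi, hcard], ?_⟩
    rw [Finset.image_image]
    have : c ∘ s = id := funext hc
    rw [this, Finset.image_id]
  have hright : Odd (∑ τ ∈ D, (R.bipartiteBelow (fun S τ => τ ⊆ S) τ).card) := by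
    rw [← Finset.add_sum_erase _ _ hτ0]
    refine Odd.add_even ?_ (Finset.even_sum _ fun τ hτ => ?_)
    · obtain ⟨F, hF⟩ := scarf_bdry r hr s hs1 hs2 hsi z hzs i0
      have : R.bipartiteBelow (fun S τ => τ ⊆ S) ((Finset.univ.erase i0).image s) = {F} := by
        ext S
        rw [hmemB, hF]; simp
      rw [this]; simp
    · obtain ⟨hne, hD⟩ := Finset.mem_erase.1 hτ
      simp only [D, Finset.mem_filter, Finset.mem_univ, true_and] at hD
      obtain ⟨y, hy, hys⟩ : ∃ y ∈ τ, y ∉ Set.range s := by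
        by_contra hall
        push Not at hall
        apply hne
        apply Finset.eq_of_subset_of_card_le
        · intro t ht
          obtain ⟨p, rfl⟩ := hall t ht
          have : c (s p) ∈ τ.image c := Finset.mem_image_of_mem _ ht
          rw [hc, hD.2] at this
          exact Finset.mem_image_of_mem _ this
        · rw [Finset.card_image_of_injective _ hsi]; omega
      rcases (R.bipartiteBelow (fun S τ => τ ⊆ S) τ).eq_empty_or_nonempty with h | ⟨S0, h⟩
      · rw [h]; simp
      obtain ⟨_, h2, h3⟩ := (hmemB _ _).1 h
      obtain ⟨F, G, hFG, hiff⟩ := scarf_door r hr s hs2 τ hD.1 y hy hys (by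
        intro y
        obtain ⟨i, hi⟩ := h2 y
        exact ⟨i, fun x hx => hi x (h3 hx)⟩)
      have : R.bipartiteBelow (fun S τ => τ ⊆ S) τ = {F, G} := by
        ext S
        rw [hmemB, hiff]; simp
      rw [this, Finset.card_pair hFG]
      exact even_two
  rw [← hcount] at hright
  exact (Nat.not_even_iff_odd.2 hright) hleft

lemma grid_lemma {I : Type*} [Fintype I] [DecidableEq I] [Nonempty I] (M : ℕ)
    (c : ↥(Finset.piAntidiag (Finset.univ : Finset I) M) → I) :
    ∃ x : ↥(Finset.piAntidiag (Finset.univ : Finset I) M), ∀ i, x.1 i < Fintype.card I ∨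
      ∃ x' : ↥(Finset.piAntidiag (Finset.univ : Finset I) M), c x' = i ∧
        ∀ j, x.1 j < x'.1 j + Fintype.card I ∧ x'.1 j < x.1 j + Fintype.card I := by
  classical
  obtain ⟨i0⟩ := ‹Nonempty I›
  have : Nonempty I := ⟨i0⟩
  let T := ↥(Finset.piAntidiag (Finset.univ : Finset I) M)
  have hsum : ∀ x : T, ∑ i, x.1 i = M := fun x => (Finset.mem_piAntidiag.1 x.2).1
  have hmk : ∀ y : I → ℕ, ∑ i, y i = M → y ∈ Finset.piAntidiag (Finset.univ : Finset I) M :=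
    fun y hy => Finset.mem_piAntidiag.2 ⟨hy, fun i _ => Finset.mem_univ i⟩
  have hle : ∀ (x : T) i, x.1 i ≤ M := fun x i => by
    refine le_trans ?_ (hsum x).le
    exact Finset.single_le_sum (f := x.1) (fun _ _ => Nat.zero_le _) (Finset.mem_univ i)
  let N := Fintype.card T
  let e : T → ℕ := fun x => (Fintype.equivFin T x : ℕ)
  have he : ∀ x, e x < N := fun x => (Fintype.equivFin T x).2
  have hei : Function.Injective e := fun x y h =>
    (Fintype.equivFin T).injective (Fin.ext h)
  let e' : I → ℕ := fun x => (Fintype.equivFin I x : ℕ)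
  have hei' : Function.Injective e' := fun x y h =>
    (Fintype.equivFin I).injective (Fin.ext h)
  let r : I → T ⊕ I → ℕ := fun i => Sum.elim (fun x => 1 + x.1 i * N + e x)
    (fun j => if j = i then 0 else 1 + (M + 1) * N + e' j)
  have hlt : ∀ i (x : T), 1 + x.1 i * N + e x < 1 + (M + 1) * N := by
    intro i x
    have := Nat.mul_le_mul_right N (hle x i)
    have := he x
    rw [Nat.succ_mul]; omega
  have hr : ∀ i, Function.Injective (r i) := by
    rintro i (x | j) (y | k) h
    · have h : 1 + x.1 i * N + e x = 1 + y.1 i * N + e y := h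
      have h' : x.1 i * N + e x = y.1 i * N + e y := by omega
      have := congrArg (· % N) h'
      simp only [Nat.mul_add_mod_self_right, Nat.mod_eq_of_lt (he _)] at this
      rw [hei this]
    · have h : 1 + x.1 i * N + e x = if k = i then 0 else 1 + (M + 1) * N + e' k := h
      have := hlt i x
      split_ifs at h <;> omega
    · have h : (if j = i then 0 else 1 + (M + 1) * N + e' j) = 1 + y.1 i * N + e y := h
      have := hlt i y
      split_ifs at h <;> omega
    · have h : (if j = i then 0 else 1 + (M + 1) * N + e' j) =
        if k = i then 0 else 1 + (M + 1) * N + e' k := h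
      split_ifs at h with h1 h2 h2
      · rw [h1, h2]
      · omega
      · omega
      · rw [hei' (by omega : e' j = e' k)]
  have hr0 : ∀ i, r i (Sum.inr i) = 0 := fun i => by simp [r]
  have hmono : ∀ i (x y : T), r i (Sum.inl y) ≤ r i (Sum.inl x) → y.1 i ≤ x.1 i := by
    intro i x y h
    have h : 1 + y.1 i * N + e y ≤ 1 + x.1 i * N + e x := h
    by_contra hc
    have := Nat.mul_le_mul_right N (Nat.succ_le_of_lt (not_le.1 hc))
    rw [Nat.succ_mul] at this
    have := he x
    omega
  let z : T := ⟨Pi.single i0 M, hmk _ (by simp)⟩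
  obtain ⟨S, hSd, hSc⟩ := scarf r hr (Sum.inr : I → T ⊕ I) (by
      intro i y hy
      rw [hr0]
      apply Nat.pos_of_ne_zero
      intro h
      exact hy (hr i (h.trans (hr0 i).symm))) (by
      rintro i j (y | y) hij hy
      · have := hlt i y
        change 1 + y.1 i * N + e y < if j = i then 0 else 1 + (M + 1) * N + e' j
        rw [if_neg hij.symm]; omega
      · exact absurd ⟨y, rfl⟩ hy) (Sum.inl z) (by simp) (Sum.elim c id) (fun i => rfl)
  have hdom : ∀ y : T, ∃ i, Sum.inr i ∉ S ∧ ∀ x : T, Sum.inl x ∈ S → y.1 i ≤ x.1 i := by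
    intro y
    obtain ⟨i, hi⟩ := hSd (Sum.inl y)
    refine ⟨i, fun h => ?_, fun x hx => hmono i x y (hi _ hx)⟩
    have := hi _ h
    rw [hr0] at this
    have h2 : r i (Sum.inl y) = 1 + y.1 i * N + e y := rfl
    omega
  have hcol : ∀ i, Sum.inr i ∉ S → ∃ x : T, Sum.inl x ∈ S ∧ c x = i := by
    intro i hi
    obtain ⟨x | j, hx, e⟩ := hSc i
    · exact ⟨x, hx, e⟩
    · have e : j = i := e
      exact absurd (e ▸ hx) hi
  let σ : Finset T := Finset.univ.filter (fun x => Sum.inl x ∈ S)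
  have hσ : ∀ x, x ∈ σ ↔ Sum.inl x ∈ S := fun x => by simp [σ]
  have hσne : σ.Nonempty := by
    obtain ⟨i, hi, _⟩ := hdom z
    obtain ⟨x, hx, _⟩ := hcol i hi
    exact ⟨x, (hσ x).2 hx⟩
  have hp : ∀ i, ∃ p ∈ σ, ∀ x ∈ σ, p.1 i ≤ x.1 i := fun i =>
    Finset.exists_min_image σ (fun x => x.1 i) hσne
  choose p hpσ hpm using hp
  let C : Finset I := Finset.univ.filter (fun i => Sum.inr i ∉ S)
  have hC : ∀ i, i ∈ C ↔ Sum.inr i ∉ S := fun i => by simp [C]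
  have hbig : M < ∑ i ∈ C, ((p i).1 i + 1) := by
    by_contra hcon
    rw [not_lt] at hcon
    let y : I → ℕ := (fun i => if i ∈ C then (p i).1 i + 1 else 0) +
      Pi.single i0 (M - ∑ i ∈ C, ((p i).1 i + 1))
    have hy : ∑ i, y i = M := by
      simp only [y, Pi.add_apply, Finset.sum_add_distrib, Finset.sum_pi_single',
        Finset.mem_univ, if_true]
      rw [Finset.sum_ite_mem, Finset.univ_inter]
      rw [Finset.sum_add_distrib] at hcon ⊢
      simp only [Finset.sum_const] at *
      simp
      simp at hcon
      omega
    obtain ⟨i, hi, hi2⟩ := hdom ⟨y, hmk y hy⟩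
    have h1 := hi2 (p i) ((hσ _).1 (hpσ i))
    have h2 : y i = (p i).1 i + 1 + (Pi.single i0 (M - ∑ i ∈ C, ((p i).1 i + 1)) : I → ℕ) i := by
      simp only [y, Pi.add_apply]
      rw [if_pos ((hC i).2 hi)]
    change y i ≤ _ at h1
    omega
  rw [Finset.sum_add_distrib] at hbig
  have hcC : ∑ i ∈ C, 1 ≤ Fintype.card I := by
    rw [← Finset.card_eq_sum_ones]; exact Finset.card_le_univ C
  have hCle : ∀ x ∈ σ, ∀ D : Finset I, ∑ i ∈ D, (p i).1 i ≤ ∑ i ∈ D, x.1 i := fun x hx D =>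
    Finset.sum_le_sum fun i _ => hpm i x hx
  have hsub : ∀ (x : T) (D : Finset I), ∑ i ∈ D, x.1 i ≤ M := fun x D => by
    refine le_trans ?_ (hsum x).le
    exact Finset.sum_le_univ_sum_of_nonneg (fun _ => Nat.zero_le _)
  have hin : ∀ x ∈ σ, ∀ i ∈ C, x.1 i < (p i).1 i + Fintype.card I := by
    intro x hx i hi
    have h1 := hCle x hx (C.erase i)
    have h2 := hsub x C
    rw [← Finset.add_sum_erase C _ hi] at hbig h2
    omega
  have hout : ∀ x ∈ σ, ∀ i, i ∉ C → x.1 i < Fintype.card I := by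
    intro x hx i hi
    have h1 := hCle x hx C
    have h2 := hsub x (insert i C)
    rw [Finset.sum_insert hi] at h2
    omega
  obtain ⟨x, hx⟩ := hσne
  refine ⟨x, fun i => ?_⟩
  by_cases hi : i ∈ C
  · right
    obtain ⟨x', hx', e⟩ := hcol i ((hC i).1 hi)
    rw [← hσ] at hx'
    refine ⟨x', e, fun j => ?_⟩
    by_cases hj : j ∈ C
    · have := hin x hx j hj
      have := hin x' hx' j hj
      have := hpm j x hx
      have := hpm j x' hx'
      omega
    · have := hout x hx j hj
      have := hout x' hx' j hj
      omega
  · left; exact hout x hx i hi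

theorem brouwer_simplex {I : Type*} [Fintype I] [Nonempty I] (g : (I → ℝ) → (I → ℝ))
    (hg : ContinuousOn g (stdSimplex ℝ I)) (hm : MapsTo g (stdSimplex ℝ I) (stdSimplex ℝ I)) :
    ∃ x ∈ stdSimplex ℝ I, g x = x := by
  classical
  have happrox : ∀ ε > 0, ∃ x ∈ stdSimplex ℝ I, ∀ i, x i ≤ g x i + ε := by
    intro ε hε
    have huc := (isCompact_stdSimplex ℝ I).uniformContinuousOn_of_continuous hg
    rw [Metric.uniformContinuousOn_iff] at huc
    obtain ⟨δ, hδ, hgd⟩ := huc (ε / 2) (by positivity)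
    obtain ⟨M, hM⟩ := exists_nat_gt ((Fintype.card I : ℝ) / min δ (ε / 2))
    have hmin : 0 < min δ (ε / 2) := by positivity
    have hM0 : (0 : ℝ) < M := lt_of_le_of_lt (by positivity) hM
    have hnM : (Fintype.card I : ℝ) / M < min δ (ε / 2) := by
      rw [div_lt_iff₀ hmin] at hM
      rw [div_lt_iff₀ hM0]; linarith
    have hn1 := hnM.trans_le (min_le_left _ _)
    have hn2 := hnM.trans_le (min_le_right _ _)
    let q : ↥(Finset.piAntidiag (Finset.univ : Finset I) M) → (I → ℝ) :=
      fun x i => (x.1 i : ℝ) / M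
    have hq : ∀ x, q x ∈ stdSimplex ℝ I := by
      intro x
      refine ⟨fun i => by positivity, ?_⟩
      have : ∑ i, x.1 i = M := (Finset.mem_piAntidiag.1 x.2).1
      simp only [q]
      rw [← Finset.sum_div, ← Nat.cast_sum, this, div_self hM0.ne']
    have hcol : ∀ x, ∃ i, q x i ≤ g (q x) i := by
      intro x
      obtain ⟨i, _, hi⟩ := Finset.exists_le_of_sum_le (s := Finset.univ) (f := q x)
        (g := g (q x)) Finset.univ_nonempty (by rw [(hq x).2, (hm (hq x)).2])
      exact ⟨i, hi⟩
    choose c hc using hcol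
    obtain ⟨x, hx⟩ := grid_lemma M c
    refine ⟨q x, hq x, fun i => ?_⟩
    rcases hx i with h | ⟨x', hx', h⟩
    · have h1 : q x i ≤ (Fintype.card I : ℝ) / M := by
        have : (x.1 i : ℝ) ≤ Fintype.card I := by exact_mod_cast h.le
        simp only [q]; gcongr
      have := (hm (hq x)).1 i
      linarith
    · have hd : ∀ j, |q x j - q x' j| ≤ (Fintype.card I : ℝ) / M := by
        intro j
        simp only [q]
        rw [← sub_div, abs_div, abs_of_pos hM0]
        gcongr
        obtain ⟨h1, h2⟩ := h j
        have h1 : (x.1 j : ℝ) ≤ x'.1 j + Fintype.card I := by exact_mod_cast h1.le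
        have h2 : (x'.1 j : ℝ) ≤ x.1 j + Fintype.card I := by exact_mod_cast h2.le
        rw [abs_le]; constructor <;> linarith
      have h3 : dist (q x) (q x') < δ := by
        rw [dist_pi_lt_iff hδ]
        intro j
        rw [Real.dist_eq]
        exact (hd j).trans_lt hn1
      have h4 := (dist_le_pi_dist _ _ i).trans_lt (hgd _ (hq x) _ (hq x') h3)
      rw [Real.dist_eq, abs_lt] at h4
      have h5 := abs_le.1 (hd i)
      have h6 := hc x'
      rw [hx'] at h6
      linarith [h4.1, h4.2, h5.1, h5.2]
  let F : (I → ℝ) → ℝ := fun x => ∑ i, max 0 (x i - g x i)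
  have hF : ContinuousOn F (stdSimplex ℝ I) := by
    refine continuousOn_finsetSum _ fun i _ => ?_
    have := (continuousOn_pi.1 hg) i
    exact ContinuousOn.sup continuousOn_const ((continuous_apply i).continuousOn.sub this)
  obtain ⟨x0, hx0, _⟩ := happrox 1 one_pos
  obtain ⟨x, hx, hmin⟩ := (isCompact_stdSimplex ℝ I).exists_isMinOn ⟨x0, hx0⟩ hF
  have hF0 : F x ≤ 0 := by
    refine le_of_forall_pos_le_add fun ε hε => ?_
    have hn : (0 : ℝ) < Fintype.card I := by exact_mod_cast Fintype.card_pos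
    obtain ⟨y, hy, hyl⟩ := happrox (ε / Fintype.card I) (by positivity)
    have h1 : F x ≤ F y := hmin hy
    have h2 : F y ≤ ∑ i : I, ε / Fintype.card I :=
      Finset.sum_le_sum fun i _ => max_le (by positivity) (by linarith [hyl i])
    rw [Finset.sum_const, Finset.card_univ, nsmul_eq_mul, mul_div_cancel₀ _ hn.ne'] at h2
    linarith
  have hle : ∀ i, x i ≤ g x i := by
    intro i
    have h1 : max 0 (x i - g x i) ≤ F x :=
      Finset.single_le_sum (f := fun i => max 0 (x i - g x i))
        (fun _ _ => le_max_left _ _) (Finset.mem_univ i)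
    have := le_max_right 0 (x i - g x i)
    linarith
  refine ⟨x, hx, ?_⟩
  have := (Finset.sum_eq_sum_iff_of_le (s := Finset.univ) (fun i _ => hle i)).1
    (by rw [hx.2, (hm hx).2])
  funext i
  exact (this i (Finset.mem_univ i)).symm

lemma proj_close {V : Type*} [NormedAddCommGroup V] [NormedSpace ℝ V]
    [UniformConvexSpace V] (U : Set V) (hUcv : Convex ℝ U) (x : V) (ε : ℝ) (hε : 0 < ε) :
    ∃ δ > 0, ∀ a ∈ U, ∀ b ∈ U, dist x a ≤ Metric.infDist x U + δ →
      dist x b ≤ Metric.infDist x U + δ → dist a b < ε := by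
  set d := Metric.infDist x U with hd
  have hd0 : 0 ≤ d := Metric.infDist_nonneg
  rcases hd0.eq_or_lt with h0 | h0
  · refine ⟨ε / 3, by positivity, fun a _ b _ h1 h2 => ?_⟩
    have := dist_triangle_left a b x
    linarith
  · obtain ⟨η, hη, h⟩ := exists_forall_closed_ball_dist_add_le_two_sub V
      (show 0 < ε / (d + 1) by positivity)
    refine ⟨min 1 (η * d / 4), by positivity, fun a ha b hb h1 h2 => ?_⟩
    set δ := min 1 (η * d / 4) with hδ
    have hδ1 : δ ≤ 1 := min_le_left _ _
    have hδ2 : δ ≤ η * d / 4 := min_le_right _ _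
    have hδ0 : 0 < δ := by positivity
    by_contra hcon
    rw [not_lt] at hcon
    have hp : 0 < d + δ := by positivity
    have hn : ∀ w : V, ‖(d + δ)⁻¹ • w‖ = ‖w‖ / (d + δ) := fun w => by
      rw [norm_smul, norm_inv, Real.norm_of_nonneg hp.le, div_eq_inv_mul]
    have := @h ((d + δ)⁻¹ • (x - a)) (by
        rw [hn, div_le_one hp, ← dist_eq_norm]; exact h1)
      ((d + δ)⁻¹ • (x - b)) (by rw [hn, div_le_one hp, ← dist_eq_norm]; exact h2)
      (by
        rw [← smul_sub, hn, sub_sub_sub_cancel_left, ← dist_eq_norm, dist_comm]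
        gcongr)
    rw [← smul_add, hn, div_le_iff₀ hp] at this
    have hmid : (1 / 2 : ℝ) • a + (1 / 2 : ℝ) • b ∈ U :=
      hUcv ha hb (by norm_num) (by norm_num) (by norm_num)
    have h3 := Metric.infDist_le_dist_of_mem (x := x) hmid
    have h4 : x - a + (x - b) = (2 : ℝ) • (x - ((1 / 2 : ℝ) • a + (1 / 2 : ℝ) • b)) := by
      module
    rw [h4, norm_smul, ← dist_eq_norm, Real.norm_of_nonneg (by norm_num)] at this
    nlinarith

lemma exists_proj {V : Type*} [NormedAddCommGroup V] [NormedSpace ℝ V]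
    [UniformConvexSpace V] [CompleteSpace V]
    (U : Set V) (hUne : U.Nonempty) (hUcl : IsClosed U) (hUcv : Convex ℝ U) :
    ∃ P : V → U, Continuous P ∧ ∀ x, dist x (P x : V) = Metric.infDist x U := by
  have hex : ∀ x, ∃ p : U, dist x (p : V) = Metric.infDist x U := by
    intro x
    have : ∀ n : ℕ, ∃ a ∈ U, dist x a < Metric.infDist x U + 1 / ((n : ℝ) + 1) := fun n =>
      (Metric.infDist_lt_iff hUne).1 (by
        have : 0 < 1 / ((n : ℝ) + 1) := by positivity
        linarith)
    choose a haU had using this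
    have hlim := tendsto_one_div_add_atTop_nhds_zero_nat (𝕜 := ℝ)
    have hcs : CauchySeq a := by
      rw [Metric.cauchySeq_iff]
      intro ε hε
      obtain ⟨δ, hδ, h⟩ := proj_close U hUcv x ε hε
      obtain ⟨N, hN⟩ := eventually_atTop.1 (hlim.eventually (gt_mem_nhds hδ))
      refine ⟨N, fun m hm n hn => h _ (haU m) _ (haU n) ?_ ?_⟩
      · linarith [had m, hN m hm]
      · linarith [had n, hN n hn]
    obtain ⟨p, hp⟩ := cauchySeq_tendsto_of_complete hcs
    have hpU : p ∈ U := hUcl.mem_of_tendsto hp (Eventually.of_forall haU)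
    refine ⟨⟨p, hpU⟩, le_antisymm ?_ (Metric.infDist_le_dist_of_mem hpU)⟩
    have h1 : Tendsto (fun n => dist x (a n)) atTop (𝓝 (dist x p)) := tendsto_const_nhds.dist hp
    have h2 : Tendsto (fun n : ℕ => Metric.infDist x U + 1 / ((n : ℝ) + 1)) atTop
        (𝓝 (Metric.infDist x U + 0)) := tendsto_const_nhds.add hlim
    rw [add_zero] at h2
    exact le_of_tendsto_of_tendsto' h1 h2 fun n => (had n).le
  choose P hP using hex
  refine ⟨P, ?_, hP⟩
  rw [Metric.continuous_iff]
  intro x ε hε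
  obtain ⟨δ, hδ, h⟩ := proj_close U hUcv x ε hε
  refine ⟨δ / 2, by positivity, fun y hy => ?_⟩
  rw [Subtype.dist_eq]
  refine h _ (P y).2 _ (P x).2 ?_ ?_
  · have h1 := dist_triangle x y (P y)
    have h2 := Metric.infDist_le_infDist_add_dist (s := U) (x := y) (y := x)
    rw [hP y] at h1
    rw [dist_comm x y] at h1
    linarith
  · rw [hP x]; linarith

theorem kakutani {V : Type*} [NormedAddCommGroup V] [NormedSpace ℝ V] [CompleteSpace V]
    (T : V → Set V) (hne : ∀ v, (T v).Nonempty) (hcv : ∀ v, Convex ℝ (T v))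
    (hcl : ∀ v, IsClosed (T v)) (Q : Set V) (hQ : IsCompact Q) (hTQ : ∀ v, T v ⊆ Q)
    (husc : ∀ v, ∀ W : Set V, IsOpen W → T v ⊆ W → ∀ᶠ v' in 𝓝 v, T v' ⊆ W) :
    ∃ v, v ∈ T v := by
  classical
  choose y hy using hne
  have hHtb : TotallyBounded (convexHull ℝ Q) := hQ.totallyBounded.convexHull
  have happ : ∀ ε > 0, ∃ x ∈ convexHull ℝ Q, ∀ W : Set V, Convex ℝ W →
      (∀ c, dist x c < ε → T c ⊆ W) → x ∈ W := by
    intro ε hε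
    obtain ⟨t, htf, ht⟩ := Metric.totallyBounded_iff.1 hHtb ε hε
    have := htf.fintype
    have hpt : ∀ x ∈ convexHull ℝ Q, ∃ c : t, dist x c < ε := by
      intro x hx
      have := ht hx
      simp only [mem_iUnion, Metric.mem_ball] at this
      obtain ⟨c, hc, h⟩ := this
      exact ⟨⟨c, hc⟩, h⟩
    have hyH : ∀ v, y v ∈ convexHull ℝ Q := fun v => subset_convexHull ℝ Q (hTQ v (hy v))
    have : Nonempty t := (hpt _ (hyH 0)).nonempty
    let φ : t → V → ℝ := fun c x => max 0 (ε - dist x c)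
    have hφc : ∀ c, Continuous (φ c) := fun c => by fun_prop
    have hφ0 : ∀ c x, 0 ≤ φ c x := fun c x => le_max_left _ _
    have hs : ∀ x ∈ convexHull ℝ Q, 0 < ∑ c, φ c x := by
      intro x hx
      obtain ⟨c, hc⟩ := hpt x hx
      refine Finset.sum_pos' (fun c _ => hφ0 c x) ⟨c, Finset.mem_univ _, ?_⟩
      exact lt_max_of_lt_right (by linarith)
    let L : (t → ℝ) → V := fun l => ∑ c, l c • y c
    have hLc : Continuous L := by fun_prop
    have hL : ∀ l ∈ stdSimplex ℝ t, L l ∈ convexHull ℝ Q := fun l hl =>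
      (convex_convexHull ℝ Q).sum_mem (fun c _ => hl.1 c) hl.2 (fun c _ => hyH c)
    obtain ⟨l, hl, hfix⟩ := brouwer_simplex (fun l c => φ c (L l) / ∑ c', φ c' (L l)) (by
        refine continuousOn_pi.2 fun c => ?_
        refine ContinuousOn.div ((hφc c).comp hLc).continuousOn ?_ fun l hl => (hs _ (hL l hl)).ne'
        exact (continuous_finsetSum _ fun c _ => (hφc c).comp hLc).continuousOn) (by
        intro l hl
        refine ⟨fun c => div_nonneg (hφ0 _ _) (hs _ (hL l hl)).le, ?_⟩
        rw [← Finset.sum_div, div_self (hs _ (hL l hl)).ne'])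
    refine ⟨L l, hL l hl, fun W hW hcW => ?_⟩
    have := hW.finsum_mem (w := l) (z := fun c => y c) hl.1
      (by rw [finsum_eq_sum_of_fintype]; exact hl.2) (by
        intro c hc
        refine hcW c ?_ (hy c)
        by_contra hd
        apply hc
        rw [← hfix]
        have : φ c (L l) = 0 := max_eq_left (by linarith)
        simp only [this, zero_div])
    rw [finsum_eq_sum_of_fintype] at this
    exact this
  have hlim := tendsto_one_div_add_atTop_nhds_zero_nat (𝕜 := ℝ)
  choose x hxH hxW using fun n : ℕ => happ (1 / ((n : ℝ) + 1)) (by positivity)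
  have hcomp : IsCompact (closure (convexHull ℝ Q)) := hHtb.closure.isCompact_of_isClosed isClosed_closure
  obtain ⟨v, _, ψ, hψ, hv⟩ := hcomp.tendsto_subseq (fun n => subset_closure (hxH n))
  refine ⟨v, ?_⟩
  rw [← (hcl v).closure_eq, Metric.mem_closure_iff]
  intro δ hδ
  have hth := husc v (Metric.thickening (δ / 2) (T v)) Metric.isOpen_thickening
    (Metric.self_subset_thickening (by positivity) _)
  obtain ⟨η, hη, hball⟩ := Metric.eventually_nhds_iff.1 hth
  have e1 := (hlim.comp hψ.tendsto_atTop).eventually (gt_mem_nhds (show 0 < η / 2 by positivity))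
  have e2 := Metric.tendsto_nhds.1 hv (min (δ / 2) (η / 2)) (by positivity)
  obtain ⟨n, h1, h2⟩ := (e1.and e2).exists
  simp only [Function.comp] at h1 h2
  have hmem := hxW (ψ n) _ ((hcv v).thickening (δ / 2)) (fun c hc => hball (by
    have := dist_triangle_left c v (x (ψ n))
    have := min_le_right (δ / 2) (η / 2)
    linarith))
  obtain ⟨w, hw, hd⟩ := Metric.mem_thickening_iff.1 hmem
  refine ⟨w, hw, ?_⟩
  have := dist_triangle_left v w (x (ψ n))
  have := min_le_left (δ / 2) (η / 2)
  linarith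

/-- Existence of a best approximate solution for a quasi-optimization problem over a
uniformly convex Banach space. -/
theorem stmt12 {V : Type*} [NormedAddCommGroup V] [NormedSpace ℝ V]
    [UniformConvexSpace V] [CompleteSpace V]
    (U : Set V) (hUne : U.Nonempty) (hUcl : IsClosed U) (hUcv : Convex ℝ U)
    (f : V → ℝ) (hfc : Continuous f)
    (hfq : ∀ a b : V, ∀ t : ℝ, 0 ≤ t → t ≤ 1 → min (f a) (f b) ≤ f (t • a + (1 - t) • b))
    (K : ↥U → Set V)
    (hKusc : ∀ u : ↥U, ∀ W : Set V, IsOpen W → K u ⊆ W → ∀ᶠ u' in 𝓝 u, K u' ⊆ W)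
    (hKlsc : ∀ u : ↥U, ∀ W : Set V, IsOpen W → (K u ∩ W).Nonempty →
      ∀ᶠ u' in 𝓝 u, (K u' ∩ W).Nonempty)
    (hKne : ∀ u, (K u).Nonempty) (hKcl : ∀ u, IsClosed (K u))
    (hKcv : ∀ u, Convex ℝ (K u))
    (hKcpt : IsCompact (closure (⋃ u : ↥U, K u))) :
    ∃ u : ↥U, ∃ v : V,
      ‖v - (u : V)‖ = ⨅ w : U, ‖v - (w : V)‖ ∧
      v ∈ K u ∧ ∀ w ∈ K u, f w ≤ f v := by
  obtain ⟨P, hPc, hP⟩ := exists_proj U hUne hUcl hUcv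
  have hKQ : ∀ u, K u ⊆ closure (⋃ u : ↥U, K u) := fun u =>
    (subset_iUnion K u).trans subset_closure
  have hKc : ∀ u, IsCompact (K u) := fun u => hKcpt.of_isClosed_subset (hKcl u) (hKQ u)
  let A : U → Set V := fun u => {v | v ∈ K u ∧ ∀ w ∈ K u, f w ≤ f v}
  have hAne : ∀ u, (A u).Nonempty := by
    intro u
    obtain ⟨v, hv, hm⟩ := (hKc u).exists_isMaxOn (hKne u) hfc.continuousOn
    exact ⟨v, hv, fun w hw => hm hw⟩
  have hAcv : ∀ u, Convex ℝ (A u) := by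
    intro u a ha b hb s t hs ht hst
    refine ⟨hKcv u ha.1 hb.1 hs ht hst, fun w hw => ?_⟩
    have := hfq a b s hs (by linarith)
    rw [show 1 - s = t by linarith] at this
    exact (le_min (ha.2 w hw) (hb.2 w hw)).trans this
  have hAcl : ∀ u, IsClosed (A u) := by
    intro u
    have : A u = K u ∩ ⋂ w ∈ K u, {v | f w ≤ f v} := by
      ext v; simp [A]
    rw [this]
    exact (hKcl u).inter (isClosed_biInter fun w _ => isClosed_le continuous_const hfc)
  have hAusc : ∀ u : ↥U, ∀ W : Set V, IsOpen W → A u ⊆ W → ∀ᶠ u' in 𝓝 u, A u' ⊆ W := by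
    intro u W hW hAW
    obtain ⟨v, hv⟩ := hAne u
    obtain ⟨β, hβ, hKβ⟩ : ∃ β < f v, K u \ W ⊆ {x | f x < β} := by
      rcases (K u \ W).eq_empty_or_nonempty with h | h
      · exact ⟨f v - 1, by linarith, by rw [h]; exact empty_subset _⟩
      · obtain ⟨p, hp, hpm⟩ := ((hKc u).diff hW).exists_isMaxOn h hfc.continuousOn
        have hlt : f p < f v := by
          by_contra hcon
          rw [not_lt] at hcon
          exact hp.2 (hAW ⟨hp.1, fun w hw => (hv.2 w hw).trans hcon⟩)
        refine ⟨(f p + f v) / 2, by linarith, fun q hq => ?_⟩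
        have : f q ≤ f p := hpm hq
        change f q < _
        linarith
    have e1 := hKusc u (W ∪ {x | f x < β}) (hW.union (isOpen_lt hfc continuous_const)) (by
      intro q hq
      by_cases h : q ∈ W
      · exact Or.inl h
      · exact Or.inr (hKβ ⟨hq, h⟩))
    have e2 := hKlsc u {x | β < f x} (isOpen_lt continuous_const hfc) ⟨v, hv.1, hβ⟩
    filter_upwards [e1, e2] with u' h1 h2 q hq
    obtain ⟨w, hw, hwβ⟩ := h2
    rcases h1 hq.1 with h | h
    · exact h
    · have h3 := hq.2 w hw
      have h4 : β < f w := hwβ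
      have h5 : f q < β := h
      linarith
  obtain ⟨v, hv⟩ := kakutani (fun v => A (P v)) (fun v => hAne _) (fun v => hAcv _)
    (fun v => hAcl _) _ hKcpt (fun v q hq => hKQ _ hq.1)
    (fun v W hW h => hPc.continuousAt.eventually (hAusc (P v) W hW h))
  refine ⟨P v, v, ?_, hv.1, hv.2⟩
  rw [← dist_eq_norm, hP v, Metric.infDist_eq_iInf]
  simp only [dist_eq_norm]
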